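/- For every k ∈ ℕ there exists a constant C(k) > 0 such that for all a ≥ 0, all 0 < s ≤ s* ≤ 1, and every smooth function f : Δ̲_{≤s*} → ℝ, one has ‖f‖_{C_b^k(Δ̲_{≤s})} ≤ C(k) · (s/s*)^{a+k+2} · ‖f‖_{H_data^{a,k+3}(Δ̲_{≤s*})} (as an inequality in [0,∞]). -/

import Mathlib

open MeasureTheory

/-- The operator `f ↦ |y| ∂_{y^i} f`, with the derivative taken within the set `W`
(the domain on which `f` is smooth). -/
noncomputable def homDeriv (W : Set (EuclideanSpace ℝ (Fin 3))) (i : Fin 3)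
    (f : EuclideanSpace ℝ (Fin 3) → ℝ) : EuclideanSpace ℝ (Fin 3) → ℝ :=
  fun y => ‖y‖ * fderivWithin ℝ f W y (EuclideanSpace.single i 1)

/-- Iterated derivatives `(|y|∂_{y^{i₁}}) ⋯ (|y|∂_{y^{i_j}}) f`. -/
noncomputable def homDerivIter (W : Set (EuclideanSpace ℝ (Fin 3))) :
    (j : ℕ) → (Fin j → Fin 3) → (EuclideanSpace ℝ (Fin 3) → ℝ) →
      EuclideanSpace ℝ (Fin 3) → ℝ
  | 0, _, f => f
  | j + 1, l, f => homDeriv W (l 0) (homDerivIter W j (fun m => l m.succ) f)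

/-- The homogeneous norm `‖f‖_{H_b^k(U)}` (valued in `[0,∞]`), with
`‖f‖²_{H_b^k(U)} = Σ_{j=0}^{k} Σ_{i₁,…,i_j} ∫_U |(|y|∂_{i₁})⋯(|y|∂_{i_j}) f|² |y|⁻³ dy`;
derivatives are taken within `W`. -/
noncomputable def HbNorm (W U : Set (EuclideanSpace ℝ (Fin 3))) (k : ℕ)
    (f : EuclideanSpace ℝ (Fin 3) → ℝ) : ENNReal :=
  (∑ j ∈ Finset.range (k + 1), ∑ l : Fin j → Fin 3,
    ∫⁻ y in U, ENNReal.ofReal ((homDerivIter W j l f y) ^ 2 / ‖y‖ ^ 3)) ^ (1/2 : ℝ)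

/-- The homogeneous norm `‖f‖_{C_b^k(U)}` (valued in `[0,∞]`),
`Σ_{j=0}^{k} Σ_{i₁,…,i_j} sup_U |(|y|∂_{i₁})⋯(|y|∂_{i_j}) f|`. -/
noncomputable def CbNorm (W U : Set (EuclideanSpace ℝ (Fin 3))) (k : ℕ)
    (f : EuclideanSpace ℝ (Fin 3) → ℝ) : ENNReal :=
  ∑ j ∈ Finset.range (k + 1), ∑ l : Fin j → Fin 3,
    ⨆ y ∈ U, ENNReal.ofReal |homDerivIter W j l f y|

/-- The closed annulus `A(s₀,s₁) = {y ∈ ℝ³ : s₀ ≤ |y| ≤ s₁}`. -/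
def annulus (s₀ s₁ : ℝ) : Set (EuclideanSpace ℝ (Fin 3)) := {y | s₀ ≤ ‖y‖ ∧ ‖y‖ ≤ s₁}

/-- The punctured ball `Δ̲_{≤s} = {y ∈ ℝ³ : 0 < |y| ≤ s}`. -/
def deltaData (s : ℝ) : Set (EuclideanSpace ℝ (Fin 3)) := {y | 0 < ‖y‖ ∧ ‖y‖ ≤ s}

/-- The weighted data norm
`‖f‖_{H_data^{a,k}(Δ̲_{≤s*})} = ∫₀^{s*} (s*/s)^{a+k-1} (1+|log(s*/s)|)^{k-1}
  ‖f‖_{H_b^k(A(s/3,s))} ds/s` (valued in `[0,∞]`). -/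
noncomputable def HdataNorm (sstar a : ℝ) (k : ℕ)
    (f : EuclideanSpace ℝ (Fin 3) → ℝ) : ENNReal :=
  ∫⁻ s in Set.Ioc (0 : ℝ) sstar,
    ENNReal.ofReal ((sstar / s) ^ (a + (k : ℝ) - 1) * (1 + |Real.log (sstar / s)|) ^ (k - 1) / s) *
      HbNorm (deltaData sstar) (annulus (s / 3) s) k f

open scoped ContDiff

abbrev E3 := EuclideanSpace ℝ (Fin 3)

lemma ftc_enn (φ φ' : ℝ → ℝ) (a b : ℝ) (hab : a ≤ b)
    (hd : ∀ τ ∈ Set.Icc a b, HasDerivAt φ (φ' τ) τ) (hc : ContinuousOn φ' (Set.Icc a b)) :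
    ENNReal.ofReal |φ b - φ a| ≤ ∫⁻ τ in Set.Ioc a b, ENNReal.ofReal |φ' τ| := by
  have h := intervalIntegral.integral_eq_sub_of_hasDerivAt (f := φ) (f' := φ') (a := a) (b := b)
    (by rw [Set.uIcc_of_le hab]; exact hd)
    (by apply ContinuousOn.intervalIntegrable; rwa [Set.uIcc_of_le hab])
  rw [← h, intervalIntegral.integral_of_le hab, ← Real.enorm_eq_ofReal_abs]
  refine (enorm_integral_le_lintegral_enorm _).trans ?_
  simp [Real.enorm_eq_ofReal_abs]

lemma uniqueDiffOn_deltaData {R : ℝ} (hR : 0 < R) : UniqueDiffOn ℝ (deltaData R) := by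
  have : deltaData R = Metric.closedBall (0 : E3) R ∩ {0}ᶜ := by
    ext y; simp [deltaData, and_comm]
  rw [this]
  apply UniqueDiffOn.inter _ (isOpen_compl_singleton)
  apply uniqueDiffOn_convex (convex_closedBall _ _)
  rw [interior_closedBall _ hR.ne']
  exact ⟨0, by simpa⟩

lemma contDiffOn_homDeriv {R : ℝ} (hR : 0 < R) {g : E3 → ℝ}
    (hg : ContDiffOn ℝ ∞ g (deltaData R)) (i : Fin 3) :
    ContDiffOn ℝ ∞ (homDeriv (deltaData R) i g) (deltaData R) := by
  unfold homDeriv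
  apply ContDiffOn.mul
  · intro x hx
    apply ContDiffAt.contDiffWithinAt
    exact contDiffAt_norm ℝ (norm_pos_iff.1 hx.1)
  · have := hg.fderivWithin (m := ∞) (uniqueDiffOn_deltaData hR) (by simp)
    exact this.clm_apply contDiffOn_const

lemma contDiffOn_homDerivIter {R : ℝ} (hR : 0 < R) {g : E3 → ℝ}
    (hg : ContDiffOn ℝ ∞ g (deltaData R)) (j : ℕ) : ∀ (l : Fin j → Fin 3),
    ContDiffOn ℝ ∞ (homDerivIter (deltaData R) j l g) (deltaData R) := by
  induction j with
  | zero => intro l; exact hg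
  | succ j ih => intro l; exact contDiffOn_homDeriv hR (ih _) _

lemma deltaData_mem_nhds {R : ℝ} {x : E3} (hx : 0 < ‖x‖) (hx2 : ‖x‖ < R) :
    deltaData R ∈ nhds x := by
  have : IsOpen {y : E3 | 0 < ‖y‖ ∧ ‖y‖ < R} :=
    (isOpen_lt continuous_const continuous_norm).inter (isOpen_lt continuous_norm continuous_const)
  exact Filter.mem_of_superset (this.mem_nhds ⟨hx, hx2⟩) (fun y hy => ⟨hy.1, hy.2.le⟩)

/-- derivative along a line -/
lemma line_deriv {R : ℝ} {g : E3 → ℝ}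
    (hg : ContDiffOn ℝ ∞ g (deltaData R)) (y z : E3) (τ : ℝ)
    (hx : 0 < ‖y + τ • z‖) (hx2 : ‖y + τ • z‖ < R) :
    HasDerivAt (fun τ : ℝ => g (y + τ • z))
      (∑ i, z i * (‖y + τ • z‖⁻¹ * homDeriv (deltaData R) i g (y + τ • z))) τ := by
  have hn := deltaData_mem_nhds hx hx2
  have hd : DifferentiableAt ℝ g (y + τ • z) :=
    (hg.contDiffAt hn).differentiableAt (by simp)
  have hl : HasDerivAt (fun τ : ℝ => y + τ • z) z τ := by
    simpa using ((hasDerivAt_id τ).smul_const z).const_add y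
  have := hd.hasFDerivAt.comp_hasDerivAt τ hl
  have hz : z = ∑ i, z i • EuclideanSpace.single i (1 : ℝ) := by
    ext j; simp [Finset.sum_apply, Pi.single_apply]
  have key : fderiv ℝ g (y + τ • z) z =
      ∑ i, z i * (‖y + τ • z‖⁻¹ * homDeriv (deltaData R) i g (y + τ • z)) := by
    have h0 : fderiv ℝ g (y + τ • z) z = fderiv ℝ g (y + τ • z)
      (∑ i, z i • EuclideanSpace.single i (1 : ℝ)) := congrArg _ hz
    rw [h0, map_sum]
    refine Finset.sum_congr rfl fun i _ => ?_
    rw [map_smul, smul_eq_mul, homDeriv, fderivWithin_of_mem_nhds hn,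
      inv_mul_cancel_left₀ hx.ne']
  rw [← key]
  exact this

lemma line_cont {R : ℝ} {g : E3 → ℝ}
    (hg : ContDiffOn ℝ ∞ g (deltaData R)) (y z : E3) (s : Set ℝ)
    (hx : ∀ τ ∈ s, 0 < ‖y + τ • z‖ ∧ ‖y + τ • z‖ < R) :
    ContinuousOn (fun τ : ℝ => g (y + τ • z)) s := by
  intro τ hτ
  have := (hx τ hτ)
  have hd := (hg.contDiffAt (deltaData_mem_nhds this.1 this.2)).continuousAt
  refine (ContinuousAt.comp (f := fun τ : ℝ => y + τ • z) hd (by fun_prop)).continuousWithinAt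

lemma inv_norm_deriv (y z : E3) (τ : ℝ) (hx : 0 < ‖y + τ • z‖) :
    HasDerivAt (fun τ : ℝ => ‖y + τ • z‖⁻¹)
      (-(inner ℝ (y + τ • z) z / ‖y + τ • z‖) / ‖y + τ • z‖ ^ 2) τ := by
  have hl : HasDerivAt (fun τ : ℝ => y + τ • z) z τ := by
    simpa using ((hasDerivAt_id τ).smul_const z).const_add y
  have h1 := (hl.norm_sq.sqrt (by positivity))
  have h2 : HasDerivAt (fun τ : ℝ => ‖y + τ • z‖) (inner ℝ (y + τ • z) z / ‖y + τ • z‖) τ := by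
    convert h1 using 1
    · ext t; rw [Real.sqrt_sq (norm_nonneg _)]
    · rw [Real.sqrt_sq (norm_nonneg _)]; field_simp
  exact h2.inv hx.ne'

noncomputable def Ssum (R : ℝ) (g : E3 → ℝ) (x : E3) : ℝ :=
  |g x| + ∑ i, |homDeriv (deltaData R) i g x| +
    ∑ i, ∑ j, |homDeriv (deltaData R) j (homDeriv (deltaData R) i g) x|

lemma taylor_bound {R : ℝ} (hR : 0 < R) {g : E3 → ℝ}
    (hg : ContDiffOn ℝ ∞ g (deltaData R)) (y z : E3)
    (hx : ∀ τ ∈ Set.Icc (0 : ℝ) 1, (0 < ‖y + τ • z‖ ∧ ‖y + τ • z‖ < R) ∧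
      ‖z‖ ≤ 2 * ‖y + τ • z‖) :
    ENNReal.ofReal |g y| ≤ ENNReal.ofReal (2 * Ssum R g (y + z)) +
      ∫⁻ τ in Set.Ioc (0 : ℝ) 1, ENNReal.ofReal (τ * (4 * Ssum R g (y + τ • z))) := by
  set X : Fin 3 → E3 → ℝ := fun i => homDeriv (deltaData R) i g with hX
  have hXs : ∀ i, ContDiffOn ℝ ∞ (X i) (deltaData R) := fun i => contDiffOn_homDeriv hR hg i
  have hXXs : ∀ i j, ContDiffOn ℝ ∞ (homDeriv (deltaData R) j (X i)) (deltaData R) :=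
    fun i j => contDiffOn_homDeriv hR (hXs i) j
  set h1 : ℝ → ℝ := fun τ => ∑ i, z i * (‖y + τ • z‖⁻¹ * X i (y + τ • z)) with hh1
  set N' : ℝ → ℝ := fun τ => -(inner ℝ (y + τ • z) z / ‖y + τ • z‖) / ‖y + τ • z‖ ^ 2 with hN'
  set h2 : ℝ → ℝ := fun τ => ∑ i, z i * (N' τ * X i (y + τ • z) +
    ‖y + τ • z‖⁻¹ * ∑ j, z j * (‖y + τ • z‖⁻¹ * homDeriv (deltaData R) j (X i) (y + τ • z)))
    with hh2
  have d1 : ∀ τ ∈ Set.Icc (0 : ℝ) 1, HasDerivAt (fun τ : ℝ => g (y + τ • z)) (h1 τ) τ :=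
    fun τ hτ => line_deriv hg y z τ (hx τ hτ).1.1 (hx τ hτ).1.2
  have d2 : ∀ τ ∈ Set.Icc (0 : ℝ) 1, HasDerivAt h1 (h2 τ) τ := by
    intro τ hτ
    apply HasDerivAt.fun_sum
    intro i _
    apply HasDerivAt.const_mul
    exact (inv_norm_deriv y z τ (hx τ hτ).1.1).mul
      (line_deriv (hXs i) y z τ (hx τ hτ).1.1 (hx τ hτ).1.2)
  have cN : ContinuousOn (fun τ : ℝ => ‖y + τ • z‖⁻¹) (Set.Icc 0 1) := by
    apply ContinuousOn.inv₀ (by fun_prop)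
    intro τ hτ; exact (hx τ hτ).1.1.ne'
  have cN' : ContinuousOn N' (Set.Icc 0 1) := by
    apply ContinuousOn.div
    · apply ContinuousOn.neg
      apply ContinuousOn.div (by fun_prop) (by fun_prop)
      intro τ hτ; exact (hx τ hτ).1.1.ne'
    · fun_prop
    · intro τ hτ; exact pow_ne_zero _ (hx τ hτ).1.1.ne'
  have c2 : ContinuousOn h2 (Set.Icc 0 1) := by
    apply continuousOn_finsetSum
    intro i _
    refine continuousOn_const.mul ((cN'.mul (line_cont (hXs i) y z _ fun τ hτ => (hx τ hτ).1)).add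
      (cN.mul (continuousOn_finsetSum _ fun j _ => continuousOn_const.mul
        (cN.mul (line_cont (hXXs i j) y z _ fun τ hτ => (hx τ hτ).1)))))
  have key := ftc_enn (fun τ => τ * h1 τ - g (y + τ • z)) (fun τ => τ * h2 τ) 0 1 zero_le_one
    (by
      intro τ hτ
      have := ((hasDerivAt_id' τ).fun_mul (d2 τ hτ)).fun_sub (d1 τ hτ)
      have e : τ * h2 τ = 1 * h1 τ + τ * h2 τ - h1 τ := by ring
      change HasDerivAt _ (τ * h2 τ) τ
      rw [e]
      exact this) (continuousOn_id.mul c2)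
  have zx : ∀ τ ∈ Set.Icc (0 : ℝ) 1, ‖z‖ * ‖y + τ • z‖⁻¹ ≤ 2 := by
    intro τ hτ
    rw [← div_eq_mul_inv, div_le_iff₀ (hx τ hτ).1.1]
    exact (hx τ hτ).2
  have zi : ∀ τ ∈ Set.Icc (0 : ℝ) 1, ∀ i, |z i| * ‖y + τ • z‖⁻¹ ≤ 2 := by
    intro τ hτ i
    refine le_trans ?_ (zx τ hτ)
    have : |z i| ≤ ‖z‖ := PiLp.norm_apply_le z i
    gcongr
  have b1 : |h1 1| ≤ 2 * ∑ i, |X i (y + z)| := by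
    rw [Finset.mul_sum]
    refine (Finset.abs_sum_le_sum_abs _ _).trans (Finset.sum_le_sum fun i _ => ?_)
    have := zi 1 (by simp) i
    rw [one_smul] at *
    rw [← mul_assoc, abs_mul, abs_mul, abs_inv, abs_norm]
    gcongr
  have b2 : ∀ τ ∈ Set.Icc (0 : ℝ) 1, |h2 τ| ≤ 4 * Ssum R g (y + τ • z) := by
    intro τ hτ
    have hp := (hx τ hτ).1.1
    have hz1 := zx τ hτ
    have hz2 := zi τ hτ
    have hin : |N' τ| ≤ ‖z‖ * ‖y + τ • z‖⁻¹ * ‖y + τ • z‖⁻¹ := by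
      have : |inner ℝ (y + τ • z) z| ≤ ‖y + τ • z‖ * ‖z‖ := abs_real_inner_le_norm _ _
      simp only [hN', abs_div, abs_neg, abs_norm, abs_pow]
      calc |inner ℝ (y + τ • z) z| / ‖y + τ • z‖ / ‖y + τ • z‖ ^ 2
          ≤ (‖y + τ • z‖ * ‖z‖) / ‖y + τ • z‖ / ‖y + τ • z‖ ^ 2 := by gcongr
        _ = _ := by field_simp
    calc |h2 τ| ≤ ∑ i, (4 * |X i (y + τ • z)| +
          ∑ j, 4 * |homDeriv (deltaData R) j (X i) (y + τ • z)|) := by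
          refine (Finset.abs_sum_le_sum_abs _ _).trans (Finset.sum_le_sum fun i _ => ?_)
          rw [mul_add, Finset.mul_sum, Finset.mul_sum]
          refine (abs_add_le _ _).trans (add_le_add ?_ ?_)
          · rw [abs_mul, abs_mul, ← mul_assoc]
            gcongr
            calc |z i| * |N' τ| ≤ |z i| * (‖z‖ * ‖y + τ • z‖⁻¹ * ‖y + τ • z‖⁻¹) := by gcongr
              _ = (|z i| * ‖y + τ • z‖⁻¹) * (‖z‖ * ‖y + τ • z‖⁻¹) := by ring
              _ ≤ 2 * 2 := by gcongr; exact hz2 i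
              _ = 4 := by norm_num
          · refine (Finset.abs_sum_le_sum_abs _ _).trans (Finset.sum_le_sum fun j _ => ?_)
            simp only [abs_mul, abs_inv, abs_norm]
            calc |z i| * (‖y + τ • z‖⁻¹ * (|z j| * (‖y + τ • z‖⁻¹ *
                  |homDeriv (deltaData R) j (X i) (y + τ • z)|)))
                = (|z i| * ‖y + τ • z‖⁻¹) * (|z j| * ‖y + τ • z‖⁻¹) *
                  |homDeriv (deltaData R) j (X i) (y + τ • z)| := by ring
              _ ≤ 2 * 2 * |homDeriv (deltaData R) j (X i) (y + τ • z)| := by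
                gcongr
                · exact hz2 i
                · exact hz2 j
              _ = _ := by ring
      _ = 4 * (∑ i, |X i (y + τ • z)| +
          ∑ i, ∑ j, |homDeriv (deltaData R) j (X i) (y + τ • z)|) := by
          simp only [← Finset.mul_sum, ← Finset.sum_add_distrib, ← mul_add]
      _ ≤ _ := by
          unfold Ssum
          have := abs_nonneg (g (y + τ • z))
          linarith
  have hS : |g (y + z)| + |h1 1| ≤ 2 * Ssum R g (y + z) := by
    unfold Ssum
    have := abs_nonneg (g (y + z))
    have h3 : 0 ≤ ∑ i, ∑ j, |homDeriv (deltaData R) j (homDeriv (deltaData R) i g) (y + z)| :=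
      by positivity
    linarith
  have hS0 : 0 ≤ Ssum R g (y + z) := by unfold Ssum; positivity
  have tri : |g y| ≤ 2 * Ssum R g (y + z) +
      |((1 : ℝ) * h1 1 - g (y + (1 : ℝ) • z)) - (0 * h1 0 - g (y + (0 : ℝ) • z))| := by
    refine le_trans ?_ (add_le_add_left hS _)
    simp only [one_smul, zero_smul, add_zero, one_mul, zero_mul]
    have e : g y = (g (y + z) + -h1 1) + (h1 1 - g (y + z) - (0 - g y)) := by ring
    conv_lhs => rw [e]
    refine (abs_add_le _ _).trans (add_le_add_left ((abs_add_le _ _).trans ?_) _)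
    rw [abs_neg]
  refine (ENNReal.ofReal_le_ofReal tri).trans ?_
  rw [ENNReal.ofReal_add (by positivity) (abs_nonneg _)]
  refine add_le_add_right (key.trans ?_) _
  refine setLIntegral_mono' measurableSet_Ioc fun τ hτ => ENNReal.ofReal_le_ofReal ?_
  rw [abs_mul, abs_of_pos hτ.1]
  have := b2 τ ⟨hτ.1.le, hτ.2⟩
  have := hτ.1
  gcongr

lemma cs_enn (Z : Set E3) (T : E3 → ENNReal) (hT : Measurable T) :
    ∫⁻ z in Z, T z ≤ volume Z ^ (1/2 : ℝ) * (∫⁻ z, T z ^ (2:ℝ)) ^ (1/2 : ℝ) := by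
  have := ENNReal.lintegral_mul_le_Lp_mul_Lq (volume.restrict Z) Real.HolderConjugate.two_two
    (f := fun _ => 1) (g := T) aemeasurable_const hT.aemeasurable
  simp only [Pi.mul_apply, one_mul, ENNReal.one_rpow, lintegral_const,
    Measure.restrict_apply_univ] at this
  refine this.trans ?_
  gcongr
  exact Measure.restrict_le_self

lemma scale_enn (T : E3 → ENNReal) (hT : Measurable T) (y : E3) (τ : ℝ) (hτ : 0 < τ) :
    ∫⁻ z, T (y + τ • z) = ENNReal.ofReal (τ ^ (-3 : ℝ)) * ∫⁻ z, T z := by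
  have h1 : ∫⁻ z, T (y + τ • z) = ∫⁻ x, T (y + x) ∂(Measure.map (τ • ·) volume) := by
    have m1 : Measurable (fun x => T (y + x)) := hT.comp (measurable_const_add y)
    rw [lintegral_map m1 (measurable_const_smul τ)]
  rw [h1, Measure.map_addHaar_smul _ hτ.ne', lintegral_smul_measure,
    lintegral_add_left_eq_self (fun x => T x) y]
  simp only [smul_eq_mul]
  congr 2
  rw [finrank_euclideanSpace, Fintype.card_fin, abs_of_pos (by positivity),
    Real.rpow_neg hτ.le]
  norm_cast

noncomputable def kap : ENNReal := ∫⁻ τ in Set.Ioc (0 : ℝ) 1, ENNReal.ofReal (τ ^ (-1/2 : ℝ))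

lemma kap_lt : kap < ⊤ := by
  have h : IntervalIntegrable (fun x : ℝ => x ^ (-1/2 : ℝ)) volume 0 1 :=
    intervalIntegral.intervalIntegrable_rpow' (by norm_num)
  rw [intervalIntegrable_iff_integrableOn_Ioc_of_le zero_le_one] at h
  exact h.lintegral_lt_top

lemma scal_bound (T : E3 → ENNReal) (hT : Measurable T) (y : E3) (Z : Set E3)
    (hZ : MeasurableSet Z) (c : ENNReal)
    (h : ∀ z ∈ Z, c ≤ 2 * T (y + z) + ∫⁻ τ in Set.Ioc (0 : ℝ) 1,
      ENNReal.ofReal τ * (4 * T (y + τ • z))) :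
    c * volume Z ≤ (2 + 4 * kap) * (volume Z ^ (1/2 : ℝ) * (∫⁻ z, T z ^ (2:ℝ)) ^ (1/2 : ℝ)) := by
  have hm : Measurable (fun p : E3 × ℝ => ENNReal.ofReal p.2 * (4 * T (y + p.2 • p.1))) := by
    have : Measurable (fun p : E3 × ℝ => y + p.2 • p.1) := by fun_prop
    have := hT.comp this
    simp only [Function.comp_def] at this
    fun_prop
  have hb : ∀ τ : ℝ, 0 < τ → ∫⁻ z in Z, T (y + τ • z) ≤ ENNReal.ofReal (τ ^ (-3/2 : ℝ)) *
      (volume Z ^ (1/2 : ℝ) * (∫⁻ z, T z ^ (2:ℝ)) ^ (1/2 : ℝ)) := by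
    intro τ hτ
    have m1 : Measurable (fun z : E3 => y + τ • z) := by fun_prop
    refine (cs_enn Z (fun z => T (y + τ • z)) (hT.comp m1)).trans ?_
    rw [scale_enn (fun z => T z ^ (2:ℝ)) (hT.pow_const _) y τ hτ,
      ENNReal.mul_rpow_of_nonneg _ _ (by norm_num), ENNReal.ofReal_rpow_of_pos (by positivity),
      ← Real.rpow_mul hτ.le]
    norm_num
    apply le_of_eq; ring
  calc c * volume Z = ∫⁻ z in Z, c := by simp
    _ ≤ ∫⁻ z in Z, (2 * T (y + z) + ∫⁻ τ in Set.Ioc (0 : ℝ) 1,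
      ENNReal.ofReal τ * (4 * T (y + τ • z))) := setLIntegral_mono' hZ h
    _ = 2 * (∫⁻ z in Z, T (y + z)) + ∫⁻ z in Z, ∫⁻ τ in Set.Ioc (0 : ℝ) 1,
      ENNReal.ofReal τ * (4 * T (y + τ • z)) := by
        have m1 : Measurable (fun x => T (y + x)) := hT.comp (measurable_const_add y)
        rw [lintegral_add_left (m1.const_mul 2), lintegral_const_mul _ m1]
    _ = 2 * (∫⁻ z in Z, T (y + z)) + ∫⁻ τ in Set.Ioc (0 : ℝ) 1, ∫⁻ z in Z,
      ENNReal.ofReal τ * (4 * T (y + τ • z)) := by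
        rw [lintegral_lintegral_swap hm.aemeasurable]
    _ ≤ 2 * (volume Z ^ (1/2 : ℝ) * (∫⁻ z, T z ^ (2:ℝ)) ^ (1/2 : ℝ)) +
        ∫⁻ τ in Set.Ioc (0 : ℝ) 1, ENNReal.ofReal (τ ^ (-1/2 : ℝ)) *
          (4 * (volume Z ^ (1/2 : ℝ) * (∫⁻ z, T z ^ (2:ℝ)) ^ (1/2 : ℝ))) := by
        refine add_le_add ?_ (setLIntegral_mono' measurableSet_Ioc fun τ hτ => ?_)
        · have := hb 1 one_pos
          simp only [one_smul, Real.one_rpow, ENNReal.ofReal_one, one_mul] at this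
          gcongr
        · have m1 : Measurable (fun z : E3 => y + τ • z) := by fun_prop
          have m2 : Measurable (fun z : E3 => T (y + τ • z)) := hT.comp m1
          rw [lintegral_const_mul _ (m2.const_mul 4), lintegral_const_mul _ m2]
          have h3 : ENNReal.ofReal (τ ^ (-1/2 : ℝ)) =
              ENNReal.ofReal τ * ENNReal.ofReal (τ ^ (-3/2 : ℝ)) := by
            rw [← ENNReal.ofReal_mul hτ.1.le]
            congr 1
            conv_rhs => rw [← Real.rpow_one τ, ← Real.rpow_mul hτ.1.le, ← Real.rpow_add hτ.1]
            norm_num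
          rw [h3]
          calc _ ≤ ENNReal.ofReal τ * (4 * (ENNReal.ofReal (τ ^ (-3/2 : ℝ)) *
              (volume Z ^ (1/2 : ℝ) * (∫⁻ z, T z ^ (2:ℝ)) ^ (1/2 : ℝ)))) := by
                gcongr; exact hb τ hτ.1
            _ = _ := by ring
    _ = _ := by
        rw [lintegral_mul_const _ (by fun_prop)]
        unfold kap
        ring

lemma line_geom (y z : E3) (hz : z ∈ Metric.closedBall (-((1/3 : ℝ) • y)) (‖y‖ / 3)) (τ : ℝ)
    (hτ : τ ∈ Set.Icc (0 : ℝ) 1) :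
    y + τ • z ∈ annulus (‖y‖ / 3) ‖y‖ ∧ ‖z‖ ≤ 2 * ‖y‖ / 3 := by
  obtain ⟨h0, h1⟩ := hτ
  rw [Metric.mem_closedBall, dist_eq_norm, sub_neg_eq_add] at hz
  have hy := norm_nonneg y
  have e : y + τ • z = (1 - τ / 3) • y + τ • (z + (1/3 : ℝ) • y) := by
    module
  have n1 : ‖(1 - τ / 3) • y‖ = (1 - τ / 3) * ‖y‖ := by
    rw [norm_smul, Real.norm_of_nonneg (by linarith)]
  have n2 : ‖τ • (z + (1/3 : ℝ) • y)‖ ≤ τ * (‖y‖ / 3) := by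
    rw [norm_smul, Real.norm_of_nonneg h0]; gcongr
  refine ⟨⟨?_, ?_⟩, ?_⟩
  · have := norm_sub_le_norm_add ((1 - τ / 3) • y) (τ • (z + (1/3 : ℝ) • y))
    rw [e]; nlinarith
  · have := norm_add_le ((1 - τ / 3) • y) (τ • (z + (1/3 : ℝ) • y))
    rw [e]; nlinarith
  · have e2 : z = (z + (1/3 : ℝ) • y) - (1/3 : ℝ) • y := by simp
    have n3 : ‖(1/3 : ℝ) • y‖ = ‖y‖ / 3 := by
      rw [norm_smul, Real.norm_of_nonneg (by norm_num)]; ring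
    have := norm_sub_le (z + (1/3 : ℝ) • y) ((1/3 : ℝ) • y)
    rw [e2]; linarith

lemma measurableSet_annulus (a b : ℝ) : MeasurableSet (annulus a b) := by
  apply IsClosed.measurableSet
  exact (isClosed_le continuous_const continuous_norm).inter
    (isClosed_le continuous_norm continuous_const)

lemma Ssum_sq (R : ℝ) (g : E3 → ℝ) (x : E3) : Ssum R g x ^ 2 ≤
    27 * (g x ^ 2 + ∑ i, homDeriv (deltaData R) i g x ^ 2 +
      ∑ i, ∑ j, homDeriv (deltaData R) j (homDeriv (deltaData R) i g) x ^ 2) := by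
  unfold Ssum
  set b := ∑ i, |homDeriv (deltaData R) i g x|
  set c := ∑ i, ∑ j, |homDeriv (deltaData R) j (homDeriv (deltaData R) i g) x|
  have hb : b ^ 2 ≤ 3 * ∑ i, homDeriv (deltaData R) i g x ^ 2 := by
    have := sq_sum_le_card_mul_sum_sq (s := Finset.univ)
      (f := fun i => |homDeriv (deltaData R) i g x|)
    simpa using this
  have hc : c ^ 2 ≤ 9 * ∑ i, ∑ j,
      homDeriv (deltaData R) j (homDeriv (deltaData R) i g) x ^ 2 := by
    have h1 := sq_sum_le_card_mul_sum_sq (s := Finset.univ)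
      (f := fun i => ∑ j, |homDeriv (deltaData R) j (homDeriv (deltaData R) i g) x|)
    have h2 : ∀ i, (∑ j, |homDeriv (deltaData R) j (homDeriv (deltaData R) i g) x|) ^ 2 ≤
        3 * ∑ j, homDeriv (deltaData R) j (homDeriv (deltaData R) i g) x ^ 2 := by
      intro i
      have := sq_sum_le_card_mul_sum_sq (s := Finset.univ)
        (f := fun j => |homDeriv (deltaData R) j (homDeriv (deltaData R) i g) x|)
      simpa using this
    have h3 := Finset.sum_le_sum fun i (_ : i ∈ Finset.univ) => h2 i
    rw [← Finset.mul_sum] at h3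
    simp only [Finset.card_univ, Fintype.card_fin, Nat.cast_ofNat] at h1
    linarith
  have ha := sq_abs (g x)
  have p1 : 0 ≤ ∑ i, homDeriv (deltaData R) i g x ^ 2 := by positivity
  have p2 : 0 ≤ g x ^ 2 := by positivity
  nlinarith [sq_nonneg (|g x| - b), sq_nonneg (|g x| - c), sq_nonneg (b - c)]

lemma contOn_ann {R t : ℝ} (ht : 0 < t) (htR : t < R) {F : E3 → ℝ}
    (hF : ContDiffOn ℝ ∞ F (deltaData R)) : ContinuousOn F (annulus (t / 3) t) :=
  hF.continuousOn.mono fun x hx => ⟨by have := hx.1; linarith, by have := hx.2; linarith⟩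

lemma aemeas_ann {R t : ℝ} (ht : 0 < t) (htR : t < R) {F : E3 → ℝ}
    (hF : ContDiffOn ℝ ∞ F (deltaData R)) :
    AEMeasurable (fun x => ENNReal.ofReal (F x ^ 2 / ‖x‖ ^ 3))
      (volume.restrict (annulus (t / 3) t)) := by
  apply AEMeasurable.ennreal_ofReal
  apply ContinuousOn.aemeasurable _ (measurableSet_annulus _ _)
  apply ((contOn_ann ht htR hF).pow 2).div (by fun_prop)
  intro x hx
  have := hx.1
  have : 0 < ‖x‖ := by linarith
  positivity

noncomputable def beta : ENNReal := volume (Metric.ball (0 : E3) 1)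

noncomputable def Csob : ENNReal := (2 + 4 * kap) * (351 * 27 / beta) ^ (1/2 : ℝ)

lemma beta_pos : beta ≠ 0 := (Metric.measure_ball_pos volume (0 : E3) one_pos).ne'
lemma beta_lt : beta ≠ ⊤ := measure_ball_lt_top.ne

lemma Csob_lt : Csob ≠ ⊤ := by
  unfold Csob
  apply ENNReal.mul_ne_top
  · exact ENNReal.add_ne_top.2 ⟨by simp, ENNReal.mul_ne_top (by simp) kap_lt.ne⟩
  · apply ENNReal.rpow_ne_top_of_nonneg (by norm_num)
    exact ENNReal.div_ne_top (ENNReal.mul_ne_top (by simp) (by simp)) beta_pos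

lemma sobolev_bound {R : ℝ} {g : E3 → ℝ} (hg : ContDiffOn ℝ ∞ g (deltaData R)) (y : E3)
    (hy : 0 < ‖y‖) (hyR : ‖y‖ < R) (N : ENNReal)
    (hN0 : ∫⁻ x in annulus (‖y‖ / 3) ‖y‖, ENNReal.ofReal (g x ^ 2 / ‖x‖ ^ 3) ≤ N)
    (hN1 : ∀ i, ∫⁻ x in annulus (‖y‖ / 3) ‖y‖,
      ENNReal.ofReal (homDeriv (deltaData R) i g x ^ 2 / ‖x‖ ^ 3) ≤ N)
    (hN2 : ∀ i j, ∫⁻ x in annulus (‖y‖ / 3) ‖y‖,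
      ENNReal.ofReal (homDeriv (deltaData R) j (homDeriv (deltaData R) i g) x ^ 2 / ‖x‖ ^ 3) ≤ N) :
    ENNReal.ofReal |g y| ≤ Csob * N ^ (1/2 : ℝ) := by
  have hR : 0 < R := hy.trans hyR
  set t := ‖y‖ with ht
  set A := annulus (t / 3) t with hA
  have mA : MeasurableSet A := measurableSet_annulus _ _
  have hX := fun i => contDiffOn_homDeriv hR hg i
  have hXX := fun i j => contDiffOn_homDeriv hR (hX i) j
  have cS : ContinuousOn (Ssum R g) A := by
    unfold Ssum
    refine (((contOn_ann hy hyR hg).abs).add (continuousOn_finsetSum _ fun i _ =>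
      (contOn_ann hy hyR (hX i)).abs)).add (continuousOn_finsetSum _ fun i _ =>
        continuousOn_finsetSum _ fun j _ => (contOn_ann hy hyR (hXX i j)).abs)
  set T : E3 → ENNReal := fun x => ENNReal.ofReal (A.indicator (Ssum R g) x) with hT
  have mT : Measurable T := by
    classical
    apply Measurable.ennreal_ofReal
    rw [← Set.piecewise_eq_indicator]
    exact ContinuousOn.measurable_piecewise cS continuousOn_const mA
  have TA : ∀ x ∈ A, T x = ENNReal.ofReal (Ssum R g x) := by
    intro x hx; simp [hT, Set.indicator_of_mem hx]
  set Z := Metric.closedBall (-((1/3 : ℝ) • y)) (t / 3) with hZ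
  have main := scal_bound T mT y Z Metric.isClosed_closedBall.measurableSet
    (ENNReal.ofReal |g y|) (by
      intro z hz
      have geo := fun τ hτ => line_geom y z hz τ hτ
      have := taylor_bound hR hg y z (by
        intro τ hτ
        obtain ⟨⟨h1, h2⟩, h3⟩ := geo τ hτ
        exact ⟨⟨by linarith, by linarith⟩, by linarith⟩)
      refine this.trans (add_le_add ?_ ?_)
      · have h1 := (geo 1 (by simp)).1
        rw [one_smul] at h1
        rw [TA _ h1, ENNReal.ofReal_mul (by norm_num)]
        simp
      · refine setLIntegral_mono' measurableSet_Ioc fun τ hτ => ?_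
        rw [TA _ (geo τ ⟨hτ.1.le, hτ.2⟩).1, ENNReal.ofReal_mul hτ.1.le,
          ENNReal.ofReal_mul (by norm_num)]
        simp)
  have vZ : volume Z = ENNReal.ofReal ((t / 3) ^ 3) * beta := by
    rw [hZ, Measure.addHaar_closedBall _ _ (by positivity), finrank_euclideanSpace,
      Fintype.card_fin, beta]
  have v0 : volume Z ≠ 0 := by
    rw [vZ]; exact mul_ne_zero (by simp; positivity) beta_pos
  have vt : volume Z ≠ ⊤ := by
    rw [vZ]; exact ENNReal.mul_ne_top (by simp) beta_lt
  have hT2 : ∫⁻ z, T z ^ (2:ℝ) ≤ ENNReal.ofReal (27 * t ^ 3) * (13 * N) := by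
    have e1 : ∫⁻ z, T z ^ (2:ℝ) = ∫⁻ z in A, T z ^ (2:ℝ) := by
      rw [← lintegral_indicator mA]
      congr 1
      ext x
      by_cases hx : x ∈ A
      · rw [Set.indicator_of_mem hx]
      · rw [Set.indicator_of_notMem hx]
        simp [hT, Set.indicator_of_notMem hx]
    rw [e1]
    have pw : ∀ x ∈ A, T x ^ (2:ℝ) ≤ ENNReal.ofReal (27 * t ^ 3) *
        (ENNReal.ofReal (g x ^ 2 / ‖x‖ ^ 3) +
          ((∑ i, ENNReal.ofReal (homDeriv (deltaData R) i g x ^ 2 / ‖x‖ ^ 3)) +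
          ∑ i, ∑ j, ENNReal.ofReal
            (homDeriv (deltaData R) j (homDeriv (deltaData R) i g) x ^ 2 / ‖x‖ ^ 3))) := by
      intro x hx
      have hx0 : 0 < ‖x‖ := by have := hx.1; linarith
      have hxt : ‖x‖ ≤ t := hx.2
      have S0 : 0 ≤ Ssum R g x := by unfold Ssum; positivity
      rw [TA x hx, ENNReal.ofReal_rpow_of_nonneg S0 (by norm_num)]
      have es : ∀ i, ∑ j, ENNReal.ofReal
            (homDeriv (deltaData R) j (homDeriv (deltaData R) i g) x ^ 2 / ‖x‖ ^ 3) =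
          ENNReal.ofReal (∑ j,
            homDeriv (deltaData R) j (homDeriv (deltaData R) i g) x ^ 2 / ‖x‖ ^ 3) := fun i =>
        (ENNReal.ofReal_sum_of_nonneg (fun j _ => by positivity)).symm
      simp_rw [es]
      rw [← ENNReal.ofReal_sum_of_nonneg (fun i _ => by positivity),
        ← ENNReal.ofReal_sum_of_nonneg (fun i _ => by positivity),
        ← ENNReal.ofReal_add (by positivity) (by positivity),
        ← ENNReal.ofReal_add (by positivity) (by positivity),
        ← ENNReal.ofReal_mul (by positivity)]
      apply ENNReal.ofReal_le_ofReal
      have h1 := Ssum_sq R g x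
      rw [Real.rpow_two]
      refine h1.trans ?_
      simp_rw [← Finset.sum_div]
      rw [← add_div, ← add_div, ← add_assoc, mul_assoc]
      gcongr
      rw [mul_div_assoc', le_div_iff₀ (by positivity), mul_comm]
      gcongr
    refine (setLIntegral_mono' mA pw).trans ?_
    rw [lintegral_const_mul' _ _ ENNReal.ofReal_ne_top]
    gcongr
    rw [lintegral_add_left' (aemeas_ann hy hyR hg),
      lintegral_add_left' (Finset.aemeasurable_fun_sum _ fun i _ => aemeas_ann hy hyR (hX i)),
      lintegral_finsetSum' _ (fun i _ => aemeas_ann hy hyR (hX i)),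
      lintegral_finsetSum' _ (fun i _ => Finset.aemeasurable_fun_sum _ fun j _ =>
        aemeas_ann hy hyR (hXX i j))]
    simp_rw [lintegral_finsetSum' Finset.univ (fun j _ => aemeas_ann hy hyR (hXX _ j))]
    calc _ ≤ N + (∑ i : Fin 3, N + ∑ i : Fin 3, ∑ j : Fin 3, N) := by
          gcongr with i _ i _ j _
          · exact hN1 i
          · exact hN2 i j
      _ = 13 * N := by simp; ring
  have hM : ENNReal.ofReal (27 * t ^ 3) * 13 = (351 * 27 / beta) * volume Z := by
    have : ENNReal.ofReal (27 * t ^ 3) = 27 * 27 * ENNReal.ofReal ((t/3)^3) := by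
      have e : 27 * t ^ 3 = 729 * (t/3)^3 := by ring
      rw [e, ENNReal.ofReal_mul (by norm_num)]
      norm_num
    rw [vZ, this]
    calc _ = 351 * 27 * ENNReal.ofReal ((t/3)^3) * 1 := by ring
      _ = 351 * 27 * ENNReal.ofReal ((t/3)^3) * (beta⁻¹ * beta) := by
        rw [ENNReal.inv_mul_cancel beta_pos beta_lt]
      _ = _ := by rw [ENNReal.div_eq_inv_mul]; ring
  rw [← mul_assoc, hM] at hT2
  have fin : ENNReal.ofReal |g y| * volume Z ≤ (Csob * N ^ (1/2 : ℝ)) * volume Z := by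
    refine main.trans ?_
    calc _ ≤ (2 + 4 * kap) * (volume Z ^ (1/2 : ℝ) *
          (351 * 27 / beta * volume Z * N) ^ (1/2 : ℝ)) := by gcongr
      _ = Csob * N ^ (1/2 : ℝ) * (volume Z ^ (1/2 : ℝ) * volume Z ^ (1/2 : ℝ)) := by
        rw [ENNReal.mul_rpow_of_nonneg _ _ (by norm_num),
          ENNReal.mul_rpow_of_nonneg _ _ (by norm_num), Csob]
        ring
      _ = _ := by
        rw [← ENNReal.rpow_add _ _ v0 vt]; norm_num
  exact (ENNReal.mul_le_mul_iff_left v0 vt).1 fin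

lemma radial_bound {R : ℝ} {g : E3 → ℝ} (hg : ContDiffOn ℝ ∞ g (deltaData R)) (y : E3)
    (hy : 0 < ‖y‖) (hyR : ‖y‖ < R) (H : ℝ → ENNReal)
    (h0 : ∀ x : E3, 0 < ‖x‖ → ‖x‖ < R → ENNReal.ofReal |g x| ≤ H ‖x‖)
    (h1 : ∀ i, ∀ x : E3, 0 < ‖x‖ → ‖x‖ < R →
      ENNReal.ofReal |homDeriv (deltaData R) i g x| ≤ H ‖x‖) :
    ENNReal.ofReal |g y| ≤ 5 * ∫⁻ σ in Set.Ioc 0 ‖y‖, ENNReal.ofReal (1 / σ) * H σ := by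
  have hR : 0 < R := hy.trans hyR
  set r := ‖y‖ with hr
  set J := ∫⁻ σ in Set.Ioc 0 r, ENNReal.ofReal (1 / σ) * H σ with hJ
  set u : E3 := r⁻¹ • y with hu
  have nu : ‖u‖ = 1 := by
    rw [hu, norm_smul, norm_inv, Real.norm_of_nonneg hy.le, ← hr, inv_mul_cancel₀ hy.ne']
  have nx : ∀ σ : ℝ, 0 < σ → ‖(0 : E3) + σ • u‖ = σ := by
    intro σ hσ
    rw [zero_add, norm_smul, nu, Real.norm_of_nonneg hσ.le, mul_one]
  have ey : (0 : E3) + r • u = y := by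
    rw [zero_add, hu, smul_smul, mul_inv_cancel₀ hy.ne', one_smul]
  have step : ∀ σ ∈ Set.Ioc (r / 2) r, ENNReal.ofReal |g y| ≤
      ENNReal.ofReal r * (ENNReal.ofReal (1 / σ) * H σ) + 3 * J := by
    intro σ hσ
    have hσ0 : 0 < σ := by have := hσ.1; linarith
    have pos : ∀ τ ∈ Set.Icc σ r, 0 < ‖(0 : E3) + τ • u‖ ∧ ‖(0 : E3) + τ • u‖ < R := by
      intro τ hτ
      have : 0 < τ := hσ0.trans_le hτ.1
      rw [nx τ this]
      exact ⟨this, hτ.2.trans_lt hyR⟩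
    have key := ftc_enn (fun τ => g (0 + τ • u)) (fun τ => ∑ i, u i *
      (‖(0 : E3) + τ • u‖⁻¹ * homDeriv (deltaData R) i g (0 + τ • u))) σ r hσ.2
      (fun τ hτ => line_deriv hg 0 u τ (pos τ hτ).1 (pos τ hτ).2)
      (by
        refine continuousOn_finsetSum _ fun i _ => continuousOn_const.mul (ContinuousOn.mul ?_
          (line_cont (contDiffOn_homDeriv hR hg i) 0 u _ pos))
        exact ContinuousOn.inv₀ (by fun_prop) fun τ hτ => (pos τ hτ).1.ne')
    have key2 : ENNReal.ofReal |g y - g (0 + σ • u)| ≤ 3 * J := by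
      rw [← ey]
      refine key.trans ?_
      rw [hJ, ← lintegral_const_mul' _ _ (by simp)]
      refine le_trans ?_ (lintegral_mono_set (Set.Ioc_subset_Ioc_left hσ0.le))
      refine setLIntegral_mono' measurableSet_Ioc fun τ hτ => ?_
      have hτ0 : 0 < τ := hσ0.trans hτ.1
      have hb : |∑ i, u i * (‖(0 : E3) + τ • u‖⁻¹ *
          homDeriv (deltaData R) i g (0 + τ • u))| ≤
          (1 / τ) * ∑ i, |homDeriv (deltaData R) i g (0 + τ • u)| := by
        rw [Finset.mul_sum]
        refine (Finset.abs_sum_le_sum_abs _ _).trans (Finset.sum_le_sum fun i _ => ?_)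
        rw [nx τ hτ0, abs_mul, abs_mul, abs_of_pos (inv_pos.2 hτ0), one_div]
        have : |u i| ≤ 1 := nu ▸ PiLp.norm_apply_le u i
        exact mul_le_of_le_one_left (by positivity) this
      refine (ENNReal.ofReal_le_ofReal hb).trans ?_
      rw [ENNReal.ofReal_mul (by positivity), ENNReal.ofReal_sum_of_nonneg (fun i _ => abs_nonneg _),
        mul_left_comm]
      gcongr
      have hp := pos τ ⟨hτ.1.le, hτ.2⟩
      calc _ ≤ ∑ i : Fin 3, H τ := by
            refine Finset.sum_le_sum fun i _ => ?_
            have := h1 i _ hp.1 hp.2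
            rwa [nx τ hτ0] at this
        _ = 3 * H τ := by simp
    have e : |g y| ≤ |g (0 + σ • u)| + |g y - g (0 + σ • u)| := by
      have := abs_add_le (g (0 + σ • u)) (g y - g (0 + σ • u))
      simpa using this
    refine (ENNReal.ofReal_le_ofReal e).trans ?_
    rw [ENNReal.ofReal_add (abs_nonneg _) (abs_nonneg _)]
    refine add_le_add ?_ key2
    have hp := pos σ ⟨le_rfl, hσ.2⟩
    have h2 := h0 _ hp.1 hp.2
    rw [nx σ hσ0] at h2
    refine h2.trans ?_
    rw [← mul_assoc, ← ENNReal.ofReal_mul hy.le]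
    refine le_mul_of_one_le_left (zero_le) ?_
    rw [ENNReal.one_le_ofReal, mul_one_div, one_le_div hσ0]
    exact hσ.2
  have hv : volume (Set.Ioc (r / 2) r) = ENNReal.ofReal (r / 2) := by
    rw [Real.volume_Ioc]; congr 1; ring
  have fin : ENNReal.ofReal |g y| * ENNReal.ofReal (r / 2) ≤ (5 * J) * ENNReal.ofReal (r / 2) := by
    calc _ = ∫⁻ σ in Set.Ioc (r / 2) r, ENNReal.ofReal |g y| := by simp only [lintegral_const, Measure.restrict_apply_univ, hv]
      _ ≤ ∫⁻ σ in Set.Ioc (r / 2) r, (ENNReal.ofReal r * (ENNReal.ofReal (1 / σ) * H σ) + 3 * J) :=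
        setLIntegral_mono' measurableSet_Ioc step
      _ = ENNReal.ofReal r * (∫⁻ σ in Set.Ioc (r / 2) r, (ENNReal.ofReal (1 / σ) * H σ)) +
          3 * J * ENNReal.ofReal (r / 2) := by
        rw [lintegral_add_right _ measurable_const, lintegral_const_mul' _ _ (by simp)]
        simp only [lintegral_const, Measure.restrict_apply_univ, hv]
      _ ≤ ENNReal.ofReal r * J + 3 * J * ENNReal.ofReal (r / 2) := by
        gcongr
        exact lintegral_mono_set (Set.Ioc_subset_Ioc_left (by positivity))
      _ = _ := by
        have : ENNReal.ofReal r = 2 * ENNReal.ofReal (r / 2) := by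
          rw [show r = 2 * (r / 2) by ring, ENNReal.ofReal_mul (by norm_num)]
          simp
        rw [this]; ring
  exact (ENNReal.mul_le_mul_iff_left (by simp; positivity) (by simp)).1 fin

/-- the square of the norm `HbNorm` -/
noncomputable def HbSq (W U : Set E3) (k : ℕ) (f : E3 → ℝ) : ENNReal :=
  ∑ j ∈ Finset.range (k + 1), ∑ l : Fin j → Fin 3,
    ∫⁻ y in U, ENNReal.ofReal ((homDerivIter W j l f y) ^ 2 / ‖y‖ ^ 3)

lemma term_le (W U : Set E3) (k : ℕ) (f : E3 → ℝ) (j : ℕ) (hj : j ≤ k) (l : Fin j → Fin 3) :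
    ∫⁻ y in U, ENNReal.ofReal ((homDerivIter W j l f y) ^ 2 / ‖y‖ ^ 3) ≤ HbSq W U k f := by
  unfold HbSq
  refine le_trans ?_ (Finset.single_le_sum (f := fun j => ∑ l : Fin j → Fin 3,
    ∫⁻ y in U, ENNReal.ofReal ((homDerivIter W j l f y) ^ 2 / ‖y‖ ^ 3))
    (fun _ _ => zero_le) (Finset.mem_range.2 (Nat.lt_succ_of_le hj)))
  exact Finset.single_le_sum (f := fun l : Fin j → Fin 3 =>
    ∫⁻ y in U, ENNReal.ofReal ((homDerivIter W j l f y) ^ 2 / ‖y‖ ^ 3))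
    (fun _ _ => zero_le) (Finset.mem_univ l)

lemma homDeriv_iter (W : Set E3) (j : ℕ) (l : Fin j → Fin 3) (f : E3 → ℝ) (i : Fin 3) :
    homDeriv W i (homDerivIter W j l f) =
      homDerivIter W (j + 1) (Fin.cons i l : Fin (j + 1) → Fin 3) f := by
  simp [homDerivIter]

lemma sobolev_iter {R : ℝ} {f : E3 → ℝ} (hf : ContDiffOn ℝ ∞ f (deltaData R)) (k j : ℕ)
    (hj : j + 2 ≤ k) (l : Fin j → Fin 3) (x : E3) (hx : 0 < ‖x‖) (hxR : ‖x‖ < R) :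
    ENNReal.ofReal |homDerivIter (deltaData R) j l f x| ≤
      Csob * HbNorm (deltaData R) (annulus (‖x‖ / 3) ‖x‖) k f := by
  have hR := hx.trans hxR
  refine sobolev_bound (contDiffOn_homDerivIter hR hf j l) x hx hxR
    (HbSq (deltaData R) (annulus (‖x‖ / 3) ‖x‖) k f) ?_ ?_ ?_
  · exact term_le _ _ _ _ _ (by omega) _
  · intro i
    rw [homDeriv_iter]
    exact term_le _ _ _ _ _ (by omega) _
  · intro i i'
    rw [homDeriv_iter, homDeriv_iter]
    exact term_le _ _ _ _ _ (by omega) _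

lemma point_bound {R : ℝ} {f : E3 → ℝ} (hf : ContDiffOn ℝ ∞ f (deltaData R)) (k j : ℕ)
    (hj : j ≤ k) (l : Fin j → Fin 3) (a s : ℝ) (ha : 0 ≤ a) (hs : 0 < s) (hsR : s ≤ R)
    (y : E3) (hy : 0 < ‖y‖) (hys : ‖y‖ ≤ s) (hyR : ‖y‖ < R) :
    ENNReal.ofReal |homDerivIter (deltaData R) j l f y| ≤
      5 * Csob * ENNReal.ofReal ((s / R) ^ (a + (k : ℝ) + 2)) * HdataNorm R a (k + 3) f := by
  have hR := hy.trans hyR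
  have h1 := radial_bound (contDiffOn_homDerivIter hR hf j l) y hy hyR
    (fun σ => Csob * HbNorm (deltaData R) (annulus (σ / 3) σ) (k + 3) f)
    (fun x hx hxR => sobolev_iter hf (k + 3) j (by omega) l x hx hxR)
    (fun i x hx hxR => by
      rw [homDeriv_iter]
      exact sobolev_iter hf (k + 3) (j + 1) (by omega) _ x hx hxR)
  refine h1.trans ?_
  rw [mul_assoc, mul_assoc]
  gcongr
  unfold HdataNorm
  rw [← lintegral_const_mul' _ _ ENNReal.ofReal_ne_top, ← lintegral_const_mul' _ _ Csob_lt]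
  refine le_trans ?_ (lintegral_mono_set (Set.Ioc_subset_Ioc_right (hys.trans hsR)))
  refine setLIntegral_mono' measurableSet_Ioc fun σ hσ => ?_
  rw [mul_left_comm, ← mul_assoc (ENNReal.ofReal _) (ENNReal.ofReal _),
    ← ENNReal.ofReal_mul (by positivity)]
  gcongr
  have hσ0 := hσ.1
  have e : a + ((k + 3 : ℕ) : ℝ) - 1 = a + (k : ℝ) + 2 := by push_cast; ring
  rw [e, ← mul_div_assoc, ← mul_assoc, ← Real.mul_rpow (by positivity) (by positivity)]
  gcongr
  have e2 : s / R * (R / σ) = s / σ := by field_simp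
  rw [e2]
  have g1 : 1 ≤ (s / σ) ^ (a + (k : ℝ) + 2) := by
    apply Real.one_le_rpow
    · rw [one_le_div hσ0]; exact hσ.2.trans hys
    · positivity
  have g2 : 1 ≤ (1 + |Real.log (R / σ)|) ^ (k + 3 - 1) := by
    apply one_le_pow₀
    have := abs_nonneg (Real.log (R / σ))
    linarith
  nlinarith

lemma point_bound_closed {R : ℝ} {f : E3 → ℝ} (hf : ContDiffOn ℝ ∞ f (deltaData R)) (k j : ℕ)
    (hj : j ≤ k) (l : Fin j → Fin 3) (a s : ℝ) (ha : 0 ≤ a) (hs : 0 < s) (hsR : s ≤ R)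
    (y : E3) (hy : 0 < ‖y‖) (hys : ‖y‖ ≤ s) :
    ENNReal.ofReal |homDerivIter (deltaData R) j l f y| ≤
      5 * Csob * ENNReal.ofReal ((s / R) ^ (a + (k : ℝ) + 2)) * HdataNorm R a (k + 3) f := by
  rcases lt_or_ge ‖y‖ R with h | h
  · exact point_bound hf k j hj l a s ha hs hsR y hy hys h
  have hR : 0 < R := hs.trans_le hsR
  have hc := (contDiffOn_homDerivIter hR hf j l).continuousOn y ⟨hy, hys.trans hsR⟩
  have ht : Filter.Tendsto (fun τ : ℝ => τ • y) (nhdsWithin 1 (Set.Ioo 0 1))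
      (nhdsWithin y (deltaData R)) := by
    apply tendsto_nhdsWithin_of_tendsto_nhds_of_eventually_within
    · have : Continuous (fun τ : ℝ => τ • y) := by fun_prop
      have := this.tendsto 1
      rw [one_smul] at this
      exact this.mono_left nhdsWithin_le_nhds
    · filter_upwards [self_mem_nhdsWithin] with τ hτ
      have : ‖τ • y‖ = τ * ‖y‖ := by rw [norm_smul, Real.norm_of_nonneg hτ.1.le]
      refine ⟨?_, ?_⟩
      · rw [this]; exact mul_pos hτ.1 hy
      · rw [this]
        nlinarith [hτ.1, hτ.2]
  have ht2 := (ENNReal.continuous_ofReal.comp continuous_abs).continuousAt.tendsto.comp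
    (hc.tendsto.comp ht)
  haveI : (nhdsWithin (1 : ℝ) (Set.Ioo 0 1)).NeBot := by
    rw [← mem_closure_iff_nhdsWithin_neBot, closure_Ioo (by norm_num)]
    simp
  refine le_of_tendsto ht2 ?_
  filter_upwards [self_mem_nhdsWithin] with τ hτ
  have : ‖τ • y‖ = τ * ‖y‖ := by rw [norm_smul, Real.norm_of_nonneg hτ.1.le]
  refine point_bound hf k j hj l a s ha hs hsR (τ • y) ?_ ?_ ?_
  · rw [this]; exact mul_pos hτ.1 hy
  · rw [this]; nlinarith [hτ.1, hτ.2]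
  · rw [this]; nlinarith [hτ.1, hτ.2]

/-- inequality `(eq:fCfH1)` of Lemma 6.2: for every `k` there is
`C(k) > 0` such that for all `a ≥ 0`, `0 < s ≤ s* ≤ 1` and every `f` smooth on
`Δ̲_{≤s*}`, `‖f‖_{C_b^k(Δ̲_{≤s})} ≤ C(k) (s/s*)^{a+k+2} ‖f‖_{H_data^{a,k+3}(Δ̲_{≤s*})}`
(as an inequality in `[0,∞]`). -/
theorem stmt13 (k : ℕ) :
    ∃ C : ℝ, 0 < C ∧
      ∀ a : ℝ, 0 ≤ a → ∀ s sstar : ℝ, 0 < s → s ≤ sstar → sstar ≤ 1 →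
      ∀ f : EuclideanSpace ℝ (Fin 3) → ℝ, ContDiffOn ℝ (⊤ : ℕ∞) f (deltaData sstar) →
      CbNorm (deltaData sstar) (deltaData s) k f ≤
        ENNReal.ofReal (C * (s / sstar) ^ (a + (k : ℝ) + 2)) * HdataNorm sstar a (k + 3) f := by
  set n : ENNReal := ∑ j ∈ Finset.range (k + 1), ∑ _l : Fin j → Fin 3, (1 : ENNReal) with hn
  have hnt : n ≠ ⊤ := by
    simp [hn, ENNReal.sum_eq_top]
  set D : ENNReal := n * (5 * Csob) with hD
  have hDt : D ≠ ⊤ := ENNReal.mul_ne_top hnt (ENNReal.mul_ne_top (by simp) Csob_lt)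
  refine ⟨D.toReal + 1, by positivity, ?_⟩
  intro a ha s R hs hsR _ f hf
  have hR : 0 < R := hs.trans_le hsR
  set M : ENNReal :=
    5 * Csob * ENNReal.ofReal ((s / R) ^ (a + (k : ℝ) + 2)) * HdataNorm R a (k + 3) f with hM
  calc CbNorm (deltaData R) (deltaData s) k f
      ≤ ∑ j ∈ Finset.range (k + 1), ∑ _l : Fin j → Fin 3, M := by
        unfold CbNorm
        refine Finset.sum_le_sum fun j hj => Finset.sum_le_sum fun l _ => ?_
        refine iSup₂_le fun y hy => ?_
        exact point_bound_closed hf k j (Nat.lt_succ_iff.1 (Finset.mem_range.1 hj)) l a s ha hs hsR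
          y hy.1 hy.2
    _ = n * M := by
        rw [hn, Finset.sum_mul]
        refine Finset.sum_congr rfl fun j _ => ?_
        rw [Finset.sum_mul]
        simp
    _ = D * ENNReal.ofReal ((s / R) ^ (a + (k : ℝ) + 2)) * HdataNorm R a (k + 3) f := by
        rw [hM, hD]; ring
    _ ≤ _ := by
        rw [ENNReal.ofReal_mul (by positivity)]
        gcongr
        rw [← ENNReal.ofReal_toReal hDt]
        apply ENNReal.ofReal_le_ofReal
        rw [ENNReal.toReal_ofReal ENNReal.toReal_nonneg]
        linarith
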